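/- For k = 2 and every integer j ≥ 0, there exists an S-linear isomorphism φ : D_0(f_{j+1,2}) → D_0(f_{j,2}) such that for every integer d ≥ 0, φ maps every derivation in D_0(f_{j+1,2}) that is homogeneous of degree d+3 to a derivation homogeneous of degree d. (That is, the shift isomorphism T_{A} ≅ T_{B}(3) holds for k = 2, where A = A_{A2}^{[−j,2+j]} and B = A_{A2}^{[−j−1,3+j]}.) -/

import Mathlib

open MvPolynomial

noncomputable section

abbrev S := MvPolynomial (Fin 3) ℝ

/-- The module of logarithmic derivations killing `f`. -/
def D0 (f : S) : Submodule S (Derivation ℝ S S) where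
  carrier := {θ | θ f = 0}
  add_mem' := by
    intro a b ha hb
    simp only [Set.mem_setOf_eq] at *
    simp [ha, hb]
  zero_mem' := by simp
  smul_mem' := by
    intro c θ hθ
    simp only [Set.mem_setOf_eq] at *
    simp [hθ]

def fjk (j k : ℕ) : S :=
  X 2 * ∏ s ∈ Finset.Icc (-(j : ℤ)) ((k : ℤ) + j),
    ((X 0 - C (s : ℝ) * X 2) * (X 1 - C (s : ℝ) * X 2) * (X 0 + X 1 - C (s : ℝ) * X 2))

/-- A derivation is homogeneous of degree `d` if its values on variables are. -/
def IsHomogDer (θ : Derivation ℝ S S) (d : ℕ) : Prop :=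
  ∀ i : Fin 3, (θ (X i)).IsHomogeneous d


/-! ### Homogeneous components of products -/

theorem hc_mul_aux (n d : ℕ) (p q : S) (hq : q.IsHomogeneous d) :
    homogeneousComponent n (p * q) = ∑ i ∈ Finset.range (p.totalDegree + 1),
      if i + d = n then homogeneousComponent i p * q else 0 := by
  conv_lhs => rw [← sum_homogeneousComponent p, Finset.sum_mul, map_sum]
  refine Finset.sum_congr rfl fun i _ => ?_
  rw [homogeneousComponent_of_mem (n := i + d)]
  · by_cases h : i + d = n
    · simp [h]
    · simp [h, Ne.symm h]
  · exact (mem_homogeneousSubmodule _ _).2 ((homogeneousComponent_isHomogeneous i p).mul hq)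

theorem hc_mul_add (m d : ℕ) (p q : S) (hq : q.IsHomogeneous d) :
    homogeneousComponent (m + d) (p * q) = homogeneousComponent m p * q := by
  rw [hc_mul_aux _ d p q hq]
  simp only [Nat.add_right_cancel_iff, Finset.sum_ite_eq', Finset.mem_range]
  split_ifs with h
  · rfl
  · rw [homogeneousComponent_eq_zero _ _ (by omega), zero_mul]

theorem hc_mul_lt (k d : ℕ) (hk : k < d) (p q : S) (hq : q.IsHomogeneous d) :
    homogeneousComponent k (p * q) = 0 := by
  rw [hc_mul_aux _ d p q hq]
  exact Finset.sum_eq_zero fun i _ => if_neg (by omega)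

theorem fin3_all {P : Fin 3 → Prop} (h0 : P 0) (h1 : P 1) (h2 : P 2) (i : Fin 3) : P i := by
  fin_cases i
  exacts [h0, h1, h2]

/-- Dividing by a relatively prime pair. -/
theorem prop_of_cross (F v : Fin 3 → S) (hrel : IsRelPrime (F 0) (F 1)) (h0 : F 0 ≠ 0)
    (h1 : F 0 * v 1 = F 1 * v 0) (h2 : F 0 * v 2 = F 2 * v 0) :
    ∃ r, ∀ i, v i = r * F i := by
  have hd : F 0 ∣ F 1 * v 0 := ⟨v 1, h1.symm⟩
  obtain ⟨r, hr⟩ := hrel.dvd_of_dvd_mul_left hd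
  refine ⟨r, fin3_all (by rw [hr]; ring) ?_ ?_⟩
  · apply mul_left_cancel₀ h0; rw [h1, hr]; ring
  · apply mul_left_cancel₀ h0; rw [h2, hr]; ring

/-- Substituting zero for the variable `X 0`. -/
def sub0 : S →ₐ[ℝ] S := aeval ![0, X 1, X 2]

theorem sub0_dvd (p : S) : X 0 ∣ p - sub0 p := by
  induction p using MvPolynomial.induction_on with
  | C a => simp [sub0]
  | add p q hp hq =>
    rw [map_add]
    have := dvd_add hp hq
    convert this using 1; ring
  | mul_X p i hp =>
    rw [map_mul]
    have hi : X 0 ∣ (X i : S) - sub0 (X i) := by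
      fin_cases i <;> simp [sub0]
    have : p * X i - sub0 p * sub0 (X i) = (p - sub0 p) * X i + sub0 p * (X i - sub0 (X i)) := by
      ring
    rw [this]
    exact dvd_add (Dvd.dvd.mul_right hp _) (Dvd.dvd.mul_left hi _)

theorem irred_lin (p : S) (h1 : p.IsHomogeneous 1) (h0 : p ≠ 0) : Irreducible p := by
  apply irreducible_of_totalDegree_eq_one (h1.totalDegree h0)
  intro x hx
  rw [isUnit_iff_ne_zero]
  rintro rfl
  apply h0
  ext m
  simpa using hx m

theorem relprime_lin (p q : S) (hp : p.IsHomogeneous 1)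
    (v : Fin 3 → ℝ) (hpv : eval v p = 0) (hqv : eval v q ≠ 0) (h0 : p ≠ 0) : IsRelPrime p q := by
  rw [(irred_lin p hp h0).isRelPrime_iff_not_dvd]
  rintro ⟨r, rfl⟩
  simp [hpv] at hqv

theorem relprime_X {i k : Fin 3} (h : i ≠ k) : IsRelPrime (X i : S) (X k) :=
  relprime_lin _ _ (isHomogeneous_X _ _) (Pi.single k 1) (by simp [h]) (by simp)
    (X_ne_zero i)

/-- Exactness of the Koszul complex on the variables. -/
theorem koszul (s : Fin 3 → S) (h : X 0 * s 0 + X 1 * s 1 + X 2 * s 2 = 0) :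
    ∃ p : Fin 3 → S, s 0 = X 1 * p 2 - X 2 * p 1 ∧ s 1 = X 2 * p 0 - X 0 * p 2 ∧
      s 2 = X 0 * p 1 - X 1 * p 0 := by
  obtain ⟨t1, ht1⟩ := sub0_dvd (s 1)
  obtain ⟨t2, ht2⟩ := sub0_dvd (s 2)
  have h' := congrArg sub0 h
  have e0 : sub0 (X 0) = 0 := by simp [sub0]
  have e1 : sub0 (X 1) = X 1 := by simp [sub0]
  have e2 : sub0 (X 2) = X 2 := by simp [sub0]
  simp only [map_add, map_mul, e0, e1, e2, map_zero, zero_mul, zero_add] at h'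
  have hd : (X 2 : S) ∣ X 1 * sub0 (s 1) := ⟨-sub0 (s 2), by linear_combination h'⟩
  obtain ⟨t, ht⟩ := (relprime_X (i := 2) (k := 1) (by decide)).dvd_of_dvd_mul_left hd
  have ht' : sub0 (s 2) = - X 1 * t := by
    apply mul_left_cancel₀ (X_ne_zero (R := ℝ) (2 : Fin 3))
    rw [ht] at h'
    linear_combination h'
  have hs1 : s 1 = X 2 * t + X 0 * t1 := by linear_combination ht1 + ht
  have hs2 : s 2 = - X 1 * t + X 0 * t2 := by linear_combination ht2 + ht'
  refine ⟨![t, t2, -t1], ?_, ?_, ?_⟩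
  · apply mul_left_cancel₀ (X_ne_zero (R := ℝ) (0 : Fin 3))
    rw [hs1, hs2] at h
    simp only [Matrix.cons_val]
    linear_combination h
  · simp [hs1]
  · simp [hs2]; ring

/-! ### Syzygies of three forms -/

def IsSyz (F v : Fin 3 → S) : Prop := F 0 * v 0 + F 1 * v 1 + F 2 * v 2 = 0

theorem vhc_mem (F v : Fin 3 → S) (N : ℕ) (hF : ∀ i, (F i).IsHomogeneous N) (hv : IsSyz F v)
    (m : ℕ) : IsSyz F (fun i => homogeneousComponent m (v i)) := by
  have h := congrArg (homogeneousComponent (m + N)) hv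
  rw [map_add, map_add, map_zero, mul_comm (F 0), mul_comm (F 1), mul_comm (F 2),
    hc_mul_add _ _ _ _ (hF 0), hc_mul_add _ _ _ _ (hF 1), hc_mul_add _ _ _ _ (hF 2)] at h
  unfold IsSyz
  linear_combination h

theorem syz_low_total (F : Fin 3 → S) (N n : ℕ) (hF : ∀ i, (F i).IsHomogeneous N)
    (hlow : ∀ v, IsSyz F v → ∀ m ≤ n, (∀ i, (v i).IsHomogeneous m) → v = 0)
    (v : Fin 3 → S) (hv : IsSyz F v) (hd : ∀ i, (v i).totalDegree ≤ n) : v = 0 := by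
  funext i
  rw [← sum_homogeneousComponent (v i)]
  refine Finset.sum_eq_zero fun m hm => ?_
  have hm' : m ≤ n := by
    have := hd i
    have := Finset.mem_range.1 hm
    omega
  exact congrFun (hlow _ (vhc_mem F v N hF hv m) m hm'
    (fun i => homogeneousComponent_isHomogeneous m (v i))) i

theorem const_of_deg (p : S) (h : p.totalDegree = 0) : ∃ a : ℝ, p = C a :=
  ⟨_, totalDegree_eq_zero_iff_eq_C.1 h⟩

theorem syz_dep (F : Fin 3 → S) (N n : ℕ) (hF : ∀ i, (F i).IsHomogeneous N)
    (hlow : ∀ v, IsSyz F v → ∀ m ≤ n, (∀ i, (v i).IsHomogeneous m) → v = 0)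
    (g h : Fin 3 → S) (hh : IsSyz F h)
    (hgd : ∀ i, (g i).IsHomogeneous (n + 1)) (hhd : ∀ i, (h i).IsHomogeneous (n + 1))
    (h0 : h ≠ 0) (hc : ∀ i j, g i * h j = g j * h i) : ∃ c : ℝ, ∀ i, g i = C c * h i := by
  obtain ⟨k, hk⟩ := Function.ne_iff.1 h0
  simp only [Pi.zero_apply] at hk
  obtain ⟨q, p, c, hrel, hq, hp⟩ :=
    UniqueFactorizationMonoid.exists_reduced_factors (h k) hk (g k)
  have hc0 : c ≠ 0 := by rintro rfl; simp at hq; exact hk hq.symm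
  have hq0 : q ≠ 0 := by rintro rfl; simp at hq; exact hk hq.symm
  have e : ∀ i, g i * q = h i * p := by
    intro i
    apply mul_left_cancel₀ hc0
    have := hc i k
    rw [← hq, ← hp] at this
    linear_combination this
  have hdv : ∀ i, q ∣ h i := fun i => hrel.dvd_of_dvd_mul_right ⟨g i, by rw [← e]; ring⟩
  choose u hu using hdv
  have hgu : ∀ i, g i = p * u i := by
    intro i
    apply mul_left_cancel₀ hq0
    have := e i
    rw [hu i] at this
    linear_combination this
  have husyz : IsSyz F u := by
    unfold IsSyz at *
    apply mul_left_cancel₀ hq0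
    rw [hu 0, hu 1, hu 2] at hh
    linear_combination hh
  have hdeg : ∀ i, u i ≠ 0 → q.totalDegree + (u i).totalDegree = n + 1 := by
    intro i hi
    rw [← totalDegree_mul_of_isDomain hq0 hi, ← hu]
    exact (hhd i).totalDegree (by rw [hu]; exact mul_ne_zero hq0 hi)
  have hqd : q.totalDegree = 0 := by
    by_contra hqd
    have : u = 0 := by
      apply syz_low_total F N n hF hlow u husyz
      intro i
      by_cases hi : u i = 0
      · simp [hi]
      · have := hdeg i hi
        omega
    apply hk
    rw [hu, this]
    simp
  obtain ⟨a, ha⟩ := const_of_deg q hqd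
  have ha0 : a ≠ 0 := by rintro rfl; simp [ha] at hq0
  by_cases hp0 : p = 0
  · exact ⟨0, fun i => by rw [hgu, hp0]; simp⟩
  have huk : u k ≠ 0 := by
    intro h'
    apply hk
    rw [hu, h', mul_zero]
  have hpd : p.totalDegree = 0 := by
    have h1 := hdeg k huk
    have h2 : p.totalDegree + (u k).totalDegree = n + 1 := by
      rw [← totalDegree_mul_of_isDomain hp0 huk, ← hgu]
      exact (hgd k).totalDegree (by rw [hgu]; exact mul_ne_zero hp0 huk)
    omega
  obtain ⟨b, hb⟩ := const_of_deg p hpd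
  refine ⟨b / a, fun i => ?_⟩
  rw [hgu, hu, ha, hb, ← mul_assoc, ← C_mul, div_mul_cancel₀ _ ha0]

theorem exists_r (F : Fin 3 → S) (N n : ℕ) (hF : ∀ i, (F i).IsHomogeneous N)
    (hrel : IsRelPrime (F 0) (F 1)) (h0 : F 0 ≠ 0) (g h : Fin 3 → S)
    (hg : IsSyz F g) (hh : IsSyz F h) :
    ∃ r : S, (n + n = 1 + N → (∀ i, (g i).IsHomogeneous n) → (∀ i, (h i).IsHomogeneous n) →
        r.IsHomogeneous 1) ∧
      g 1 * h 2 - g 2 * h 1 = r * F 0 ∧ g 2 * h 0 - g 0 * h 2 = r * F 1 ∧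
      g 0 * h 1 - g 1 * h 0 = r * F 2 := by
  obtain ⟨r, hr⟩ := prop_of_cross F
    ![g 1 * h 2 - g 2 * h 1, g 2 * h 0 - g 0 * h 2, g 0 * h 1 - g 1 * h 0] hrel h0
    (by simp only [Matrix.cons_val]; unfold IsSyz at *; linear_combination g 2 * hh - h 2 * hg)
    (by simp only [Matrix.cons_val]; unfold IsSyz at *; linear_combination h 1 * hg - g 1 * hh)
  have e0 := hr 0
  have e1 := hr 1
  have e2 := hr 2
  simp only [Matrix.cons_val] at e0 e1 e2
  refine ⟨r, ?_, e0, e1, e2⟩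
  intro hN hgd hhd
  have : homogeneousComponent 1 r * F 0 = r * F 0 := by
    rw [← hc_mul_add _ _ _ _ (hF 0), ← e0, ← hN]
    apply homogeneousComponent_eq_self
    exact ((hgd 1).mul (hhd 2)).sub ((hgd 2).mul (hhd 1))
  have := mul_right_cancel₀ h0 this
  rw [← this]
  exact homogeneousComponent_isHomogeneous 1 r

/-- Explicit linear independence over the reals of three vectors. -/
def Ind (a b c : Fin 3 → S) : Prop :=
  ∀ x y z : ℝ, (∀ i, C x * a i + C y * b i + C z * c i = 0) → x = 0 ∧ y = 0 ∧ z = 0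

theorem Ind.rot {a b c : Fin 3 → S} (h : Ind a b c) : Ind b c a := by
  intro x y z hx
  obtain ⟨h1, h2, h3⟩ := h z x y (fun i => by linear_combination hx i)
  exact ⟨h2, h3, h1⟩

theorem r_indep (F : Fin 3 → S) (N n : ℕ) (hF : ∀ i, (F i).IsHomogeneous N)
    (hlow : ∀ v, IsSyz F v → ∀ m ≤ n, (∀ i, (v i).IsHomogeneous m) → v = 0)
    (a b c : Fin 3 → S) (hind : Ind a b c)
    (hb : IsSyz F b) (hc : IsSyz F c)
    (had : ∀ i, (a i).IsHomogeneous (n + 1)) (hbd : ∀ i, (b i).IsHomogeneous (n + 1))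
    (hcd : ∀ i, (c i).IsHomogeneous (n + 1)) (r s t : S)
    (hr0 : b 1 * c 2 - b 2 * c 1 = r * F 0) (hr1 : b 2 * c 0 - b 0 * c 2 = r * F 1)
    (hr2 : b 0 * c 1 - b 1 * c 0 = r * F 2)
    (hs0 : c 1 * a 2 - c 2 * a 1 = s * F 0) (hs1 : c 2 * a 0 - c 0 * a 2 = s * F 1)
    (hs2 : c 0 * a 1 - c 1 * a 0 = s * F 2)
    (ht0 : a 1 * b 2 - a 2 * b 1 = t * F 0) (ht1 : a 2 * b 0 - a 0 * b 2 = t * F 1)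
    (ht2 : a 0 * b 1 - a 1 * b 0 = t * F 2)
    (x y z : ℝ) (h : C x * r + C y * s + C z * t = 0) : z = 0 := by
  by_contra hz
  have h' : C (x / z) * r + C (y / z) * s + t = 0 := by
    have := congrArg (fun e => C (1 / z) * e) h
    simp only [mul_add, mul_zero, ← mul_assoc, ← C_mul] at this
    rw [one_div_mul_cancel hz, C_1, one_mul, one_div_mul_eq_div, one_div_mul_eq_div] at this
    exact this
  set X' : S := C (x / z) with hX'
  set Y' : S := C (y / z) with hY'
  have k0 : (a 1 - X' * c 1) * (b 2 - Y' * c 2) - (a 2 - X' * c 2) * (b 1 - Y' * c 1) = 0 := by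
    linear_combination ht0 + Y' * hs0 + X' * hr0 + F 0 * h'
  have k1 : (a 2 - X' * c 2) * (b 0 - Y' * c 0) - (a 0 - X' * c 0) * (b 2 - Y' * c 2) = 0 := by
    linear_combination ht1 + Y' * hs1 + X' * hr1 + F 1 * h'
  have k2 : (a 0 - X' * c 0) * (b 1 - Y' * c 1) - (a 1 - X' * c 1) * (b 0 - Y' * c 0) = 0 := by
    linear_combination ht2 + Y' * hs2 + X' * hr2 + F 2 * h'
  have hv0 : (fun i => b i - Y' * c i) ≠ 0 := by
    intro hv
    have := hind 0 1 (-(y / z)) (fun i => by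
      have := congrFun hv i
      simp only [Pi.zero_apply] at this
      rw [map_neg, map_one, map_zero]
      linear_combination this)
    simp at this
  obtain ⟨d, hd⟩ := syz_dep F N n hF hlow (fun i => a i - X' * c i) (fun i => b i - Y' * c i)
    (by unfold IsSyz at *; linear_combination hb - Y' * hc)
    (fun i => (had i).sub ((hcd i).C_mul _)) (fun i => (hbd i).sub ((hcd i).C_mul _)) hv0
    (by
      intro i j
      fin_cases i <;> fin_cases j <;>
        simp only [Fin.zero_eta, Fin.mk_one, Fin.reduceFinMk] <;> first | rfl | skip
      · linear_combination k2
      · linear_combination -k1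
      · linear_combination -k2
      · linear_combination k0
      · linear_combination k1
      · linear_combination -k0)
  have := hind 1 (-d) (-(x / z) + d * (y / z)) (fun i => by
    have := hd i
    simp only [map_neg, map_one, map_add, map_mul]
    linear_combination this)
  simp at this

theorem lin_form (p : S) (h : p.IsHomogeneous 1) :
    ∃ a : Fin 3 → ℝ, p = C (a 0) * X 0 + C (a 1) * X 1 + C (a 2) * X 2 := by
  have h1 : p ∈ homogeneousSubmodule (Fin 3) ℝ 1 := h
  rw [homogeneousSubmodule_one_eq_span_X, Submodule.mem_span_range_iff_exists_fun] at h1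
  obtain ⟨c, hc⟩ := h1
  refine ⟨c, ?_⟩
  rw [← hc, Fin.sum_univ_three]
  simp [smul_eq_C_mul]

/-- From three independent syzygies one gets three independent ones, related by the variables. -/
theorem syz_rel (F : Fin 3 → S) (n : ℕ) (hF : ∀ i, (F i).IsHomogeneous (2 * n + 1))
    (hrel : IsRelPrime (F 0) (F 1)) (hne : ∀ i, F i ≠ 0)
    (hlow : ∀ v, IsSyz F v → ∀ m ≤ n, (∀ i, (v i).IsHomogeneous m) → v = 0)
    (g : Fin 3 → Fin 3 → S) (hg : ∀ k, IsSyz F (g k))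
    (hgd : ∀ k i, (g k i).IsHomogeneous (n + 1)) (hind : Ind (g 0) (g 1) (g 2)) :
    ∃ g' : Fin 3 → Fin 3 → S, (∀ k, IsSyz F (g' k)) ∧ (∀ k i, (g' k i).IsHomogeneous (n + 1)) ∧
      Ind (g' 0) (g' 1) (g' 2) ∧ ∀ i, X 0 * g' 0 i + X 1 * g' 1 i + X 2 * g' 2 i = 0 := by
  obtain ⟨r, hr, hr0, hr1, hr2⟩ := exists_r F _ (n + 1) hF hrel (hne 0) (g 1) (g 2) (hg 1) (hg 2)
  obtain ⟨s, hs, hs0, hs1, hs2⟩ := exists_r F _ (n + 1) hF hrel (hne 0) (g 2) (g 0) (hg 2) (hg 0)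
  obtain ⟨t, ht, ht0, ht1, ht2⟩ := exists_r F _ (n + 1) hF hrel (hne 0) (g 0) (g 1) (hg 0) (hg 1)
  replace hr := hr (by ring) (hgd 1) (hgd 2)
  replace hs := hs (by ring) (hgd 2) (hgd 0)
  replace ht := ht (by ring) (hgd 0) (hgd 1)
  have hw0 : r * g 0 0 + s * g 1 0 + t * g 2 0 = 0 := by
    apply mul_left_cancel₀ (hne 1)
    linear_combination -g 0 0 * hr1 - g 1 0 * hs1 - g 2 0 * ht1
  have hw1 : r * g 0 1 + s * g 1 1 + t * g 2 1 = 0 := by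
    apply mul_left_cancel₀ (hne 2)
    linear_combination -g 0 1 * hr2 - g 1 1 * hs2 - g 2 1 * ht2
  have hw2 : r * g 0 2 + s * g 1 2 + t * g 2 2 = 0 := by
    apply mul_left_cancel₀ (hne 0)
    linear_combination -g 0 2 * hr0 - g 1 2 * hs0 - g 2 2 * ht0
  have hrst : ∀ x y z : ℝ, C x * r + C y * s + C z * t = 0 → x = 0 ∧ y = 0 ∧ z = 0 := by
    intro x y z h
    refine ⟨?_, ?_, ?_⟩
    · exact r_indep F _ n hF hlow (g 1) (g 2) (g 0) hind.rot (hg 2) (hg 0) (hgd 1) (hgd 2)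
        (hgd 0) s t r hs0 hs1 hs2 ht0 ht1 ht2 hr0 hr1 hr2 y z x (by linear_combination h)
    · exact r_indep F _ n hF hlow (g 2) (g 0) (g 1) hind.rot.rot (hg 0) (hg 1) (hgd 2) (hgd 0)
        (hgd 1) t r s ht0 ht1 ht2 hr0 hr1 hr2 hs0 hs1 hs2 z x y (by linear_combination h)
    · exact r_indep F _ n hF hlow (g 0) (g 1) (g 2) hind (hg 1) (hg 2) (hgd 0) (hgd 1)
        (hgd 2) r s t hr0 hr1 hr2 hs0 hs1 hs2 ht0 ht1 ht2 x y z h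
  obtain ⟨a, rfl⟩ := lin_form r hr
  obtain ⟨b, rfl⟩ := lin_form s hs
  obtain ⟨c, rfl⟩ := lin_form t ht
  let L : Matrix (Fin 3) (Fin 3) ℝ := Matrix.of ![a, b, c]
  have hdet : L.det ≠ 0 := by
    intro hdet
    obtain ⟨v, hv, hv'⟩ := Matrix.exists_vecMul_eq_zero_iff.2 hdet
    have e : ∀ k, v 0 * a k + v 1 * b k + v 2 * c k = 0 := by
      intro k
      have := congrFun hv' k
      simpa [Matrix.vecMul, dotProduct, Fin.sum_univ_three, L] using this
    have e' : ∀ k, (C (v 0) * C (a k) + C (v 1) * C (b k) + C (v 2) * C (c k) : S) = 0 := by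
      intro k
      rw [← C_mul, ← C_mul, ← C_mul, ← C_add, ← C_add, e, C_0]
    obtain ⟨h1, h2, h3⟩ := hrst (v 0) (v 1) (v 2)
      (by linear_combination X 0 * e' 0 + X 1 * e' 1 + X 2 * e' 2)
    exact hv (funext (fin3_all h1 h2 h3))
  refine ⟨fun k i => C (a k) * g 0 i + C (b k) * g 1 i + C (c k) * g 2 i, ?_, ?_, ?_, ?_⟩
  · intro k
    have h0 := hg 0
    have h1 := hg 1
    have h2 := hg 2
    unfold IsSyz at *
    linear_combination C (a k) * h0 + C (b k) * h1 + C (c k) * h2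
  · intro k i
    exact (((hgd 0 i).C_mul _).add ((hgd 1 i).C_mul _)).add ((hgd 2 i).C_mul _)
  · intro x y z h
    obtain ⟨h1, h2, h3⟩ := hind (x * a 0 + y * a 1 + z * a 2) (x * b 0 + y * b 1 + z * b 2)
      (x * c 0 + y * c 1 + z * c 2) (fun i => by
        simp only [C_add, C_mul]
        linear_combination h i)
    by_contra hcon
    apply hdet
    rw [← Matrix.exists_mulVec_eq_zero_iff]
    refine ⟨![x, y, z], ?_, ?_⟩
    · intro h'
      apply hcon
      exact ⟨congrFun h' 0, congrFun h' 1, congrFun h' 2⟩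
    · refine funext (fin3_all ?_ ?_ ?_) <;>
        simp [Matrix.mulVec, dotProduct, Fin.sum_univ_three, L] <;> linarith
  · refine fin3_all ?_ ?_ ?_
    · linear_combination hw0
    · linear_combination hw1
    · linear_combination hw2

theorem syz_structure (F : Fin 3 → S) (n : ℕ) (hF : ∀ i, (F i).IsHomogeneous (2 * n + 1))
    (hrel : IsRelPrime (F 0) (F 1)) (hne : ∀ i, F i ≠ 0)
    (hlow : ∀ v, IsSyz F v → ∀ m ≤ n, (∀ i, (v i).IsHomogeneous m) → v = 0)
    (g₀ : Fin 3 → Fin 3 → S) (hg₀ : ∀ k, IsSyz F (g₀ k))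
    (hgd₀ : ∀ k i, (g₀ k i).IsHomogeneous (n + 1)) (hind₀ : Ind (g₀ 0) (g₀ 1) (g₀ 2)) :
    ∃ g : Fin 3 → Fin 3 → S, (∀ k, IsSyz F (g k)) ∧ (∀ k i, (g k i).IsHomogeneous (n + 1)) ∧
      (∀ v, IsSyz F v → ∃ p : Fin 3 → S, ∀ i, v i = p 0 * g 0 i + p 1 * g 1 i + p 2 * g 2 i) ∧
      (∀ p : Fin 3 → S, (∀ i, p 0 * g 0 i + p 1 * g 1 i + p 2 * g 2 i = 0) →
        ∃ q, ∀ k, p k = q * X k) ∧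
      (∀ i, X 0 * g 0 i + X 1 * g 1 i + X 2 * g 2 i = 0) := by
  obtain ⟨g, hg, hgd, hind, hX⟩ := syz_rel F n hF hrel hne hlow g₀ hg₀ hgd₀ hind₀
  refine ⟨g, hg, hgd, ?_⟩
  obtain ⟨r, hr, hr0, hr1, hr2⟩ := exists_r F _ (n + 1) hF hrel (hne 0) (g 1) (g 2) (hg 1) (hg 2)
  obtain ⟨s, hs, hs0, hs1, hs2⟩ := exists_r F _ (n + 1) hF hrel (hne 0) (g 2) (g 0) (hg 2) (hg 0)
  obtain ⟨t, ht, ht0, ht1, ht2⟩ := exists_r F _ (n + 1) hF hrel (hne 0) (g 0) (g 1) (hg 0) (hg 1)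
  have ht1' := ht (by ring) (hgd 0) (hgd 1)
  have ht_ne : t ≠ 0 := by
    intro h
    have := r_indep F _ n hF hlow (g 0) (g 1) (g 2) hind (hg 1) (hg 2) (hgd 0) (hgd 1)
        (hgd 2) r s t hr0 hr1 hr2 hs0 hs1 hs2 ht0 ht1 ht2 0 0 1 (by simp [h])
    simp at this
  -- the coefficients are proportional to the variables
  have hA : X 0 * s = X 1 * r := by
    apply mul_left_cancel₀ (hne 0)
    linear_combination -X 0 * hs0 + X 1 * hr0 + g 2 1 * hX 2 - g 2 2 * hX 1
  have hB : X 0 * t = X 2 * r := by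
    apply mul_left_cancel₀ (hne 0)
    linear_combination -X 0 * ht0 + X 2 * hr0 + g 1 2 * hX 1 - g 1 1 * hX 2
  obtain ⟨l, hl⟩ := prop_of_cross X ![r, s, t] (relprime_X (by decide)) (X_ne_zero _)
    (by simpa using hA) (by simpa using hB)
  have l0 := hl 0
  have l1 := hl 1
  have l2 := hl 2
  simp only [Matrix.cons_val] at l0 l1 l2
  have hl_ne : l ≠ 0 := by rintro rfl; apply ht_ne; rw [l2, zero_mul]
  have hld : l.totalDegree = 0 := by
    have h1 := ht1'.totalDegree ht_ne
    rw [l2, totalDegree_mul_of_isDomain hl_ne (X_ne_zero _), totalDegree_X] at h1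
    omega
  obtain ⟨e, rfl⟩ := const_of_deg l hld
  have he : e ≠ 0 := by rintro rfl; simp at hl_ne
  have hee : (C e * C e⁻¹ : S) = 1 := by rw [← C_mul, mul_inv_cancel₀ he, C_1]
  subst l0 l1 l2
  refine ⟨?_, ?_, hX⟩
  · intro v hv
    obtain ⟨a, -, ha0, ha1, ha2⟩ := exists_r F _ 0 hF hrel (hne 0) v (g 0) hv (hg 0)
    obtain ⟨b, -, hb0, hb1, hb2⟩ := exists_r F _ 0 hF hrel (hne 0) v (g 1) hv (hg 1)
    obtain ⟨c, -, hc0, hc1, hc2⟩ := exists_r F _ 0 hF hrel (hne 0) v (g 2) hv (hg 2)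
    obtain ⟨p, hp0, hp1, hp2⟩ := koszul ![a, b, c] (by
      simp only [Matrix.cons_val]
      apply mul_left_cancel₀ (hne 0)
      linear_combination -X 0 * ha0 - X 1 * hb0 - X 2 * hc0 + v 1 * hX 2 - v 2 * hX 1)
    simp only [Matrix.cons_val] at hp0 hp1 hp2
    -- subtracting the right combination gives something parallel to every generator
    refine ⟨fun k => C e⁻¹ * p k, fun i => ?_⟩
    have key : ∀ w : Fin 3 → S, w 1 * g 0 2 - w 2 * g 0 1 = 0 → w 2 * g 0 0 - w 0 * g 0 2 = 0 →
        w 0 * g 0 1 - w 1 * g 0 0 = 0 → w 1 * g 1 2 - w 2 * g 1 1 = 0 →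
        w 2 * g 1 0 - w 0 * g 1 2 = 0 → w 0 * g 1 1 - w 1 * g 1 0 = 0 → ∀ i, w i = 0 := by
      intro w a1 a2 a3 b1 b2 b3
      have hT : C e * X 2 * F 0 ≠ 0 := mul_ne_zero ht_ne (hne 0)
      refine fin3_all ?_ ?_ ?_
      · apply mul_left_cancel₀ hT
        rw [← ht0]
        linear_combination g 1 2 * a3 + g 1 1 * a2 + g 0 0 * b1
      · apply mul_left_cancel₀ hT
        rw [← ht0]
        linear_combination g 0 1 * b1 - g 1 1 * a1
      · apply mul_left_cancel₀ hT
        rw [← ht0]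
        linear_combination g 0 2 * b1 - g 1 2 * a1
    have := key (fun i => v i - C e⁻¹ * (p 0 * g 0 i + p 1 * g 1 i + p 2 * g 2 i)) ?_ ?_ ?_ ?_ ?_ ?_ i
    · linear_combination this
    · linear_combination ha0 + F 0 * hp0 + C e⁻¹ * p 1 * ht0 - C e⁻¹ * p 2 * hs0 - (X 1 * p 2 - X 2 * p 1) * F 0 * hee
    · linear_combination ha1 + F 1 * hp0 + C e⁻¹ * p 1 * ht1 - C e⁻¹ * p 2 * hs1 - (X 1 * p 2 - X 2 * p 1) * F 1 * hee
    · linear_combination ha2 + F 2 * hp0 + C e⁻¹ * p 1 * ht2 - C e⁻¹ * p 2 * hs2 - (X 1 * p 2 - X 2 * p 1) * F 2 * hee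
    · linear_combination hb0 + F 0 * hp1 + C e⁻¹ * p 2 * hr0 - C e⁻¹ * p 0 * ht0 - (X 2 * p 0 - X 0 * p 2) * F 0 * hee
    · linear_combination hb1 + F 1 * hp1 + C e⁻¹ * p 2 * hr1 - C e⁻¹ * p 0 * ht1 - (X 2 * p 0 - X 0 * p 2) * F 1 * hee
    · linear_combination hb2 + F 2 * hp1 + C e⁻¹ * p 2 * hr2 - C e⁻¹ * p 0 * ht2 - (X 2 * p 0 - X 0 * p 2) * F 2 * hee
  · intro p hp
    have hCe : (C e : S) ≠ 0 := hl_ne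
    have hT : C e * F 0 ≠ 0 := mul_ne_zero hCe (hne 0)
    refine prop_of_cross X p (relprime_X (by decide)) (X_ne_zero _) ?_ ?_
    · -- cross with g 2
      apply mul_left_cancel₀ hT
      linear_combination p 0 * hs0 - p 1 * hr0 + g 2 2 * hp 1 - g 2 1 * hp 2
    · apply mul_left_cancel₀ hT
      linear_combination p 0 * ht0 - p 2 * hr0 + g 1 1 * hp 2 - g 1 2 * hp 1

/-! ### Dimension counts -/

abbrev Hm (m : ℕ) : Submodule ℝ S := homogeneousSubmodule (Fin 3) ℝ m

abbrev Tri (m : ℕ) := {d : Fin 3 →₀ ℕ // d ∈ Finset.finsuppAntidiag (Finset.univ : Finset (Fin 3)) m}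

theorem card_tri (m : ℕ) : Fintype.card (Tri m) = (m + 2).choose 2 := by
  rw [Fintype.card_coe, Finset.card_finsuppAntidiag_nat_eq_choose]
  simp
  rw [Nat.add_comm 2 m, Nat.choose_symm_add]

def HmEquiv (m : ℕ) : Hm m ≃ₗ[ℝ] (Tri m →₀ ℝ) :=
  (LinearEquiv.ofEq _ _ (homogeneousSubmodule_eq_finsupp_supported (Fin 3) ℝ m)).trans
    ((AddMonoidAlgebra.supportedEquivFinsupp _).trans
      (Finsupp.domLCongr (Equiv.subtypeEquivRight (fun d => by
        simp [Finset.mem_finsuppAntidiag, Finsupp.degree_eq_sum]))))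

instance (m : ℕ) : Module.Finite ℝ (Hm m) := Module.Finite.equiv (HmEquiv m).symm

theorem finrank_Hm (m : ℕ) : Module.finrank ℝ (Hm m) = Fintype.card (Tri m) := by
  rw [(HmEquiv m).finrank_eq, Module.finrank_finsupp_self]

/-- Evaluation of forms at finitely many points. -/
def evm (m : ℕ) {ι : Type} (P : ι → Fin 3 → ℝ) : Hm m →ₗ[ℝ] (ι → ℝ) :=
  LinearMap.pi fun i => (aeval (P i)).toLinearMap ∘ₗ (Hm m).subtype

theorem evm_apply (m : ℕ) {ι : Type} (P : ι → Fin 3 → ℝ) (f : Hm m) (i : ι) :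
    evm m P f i = eval (P i) (f : S) := by
  simp [evm, aeval_eq_eval]

theorem evm_surj (m : ℕ) {ι : Type} [Fintype ι] (P : ι → Fin 3 → ℝ) (L : ι → S)
    (hL : ∀ i, (L i).IsHomogeneous m) (h0 : ∀ i, eval (P i) (L i) ≠ 0)
    (h1 : ∀ i k, i ≠ k → eval (P k) (L i) = 0) : Function.Surjective (evm m P) := by
  classical
  intro v
  refine ⟨∑ i, (v i / eval (P i) (L i)) • (⟨L i, hL i⟩ : Hm m), ?_⟩
  funext k
  rw [map_sum, Finset.sum_apply, Finset.sum_eq_single k]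
  · rw [map_smul, Pi.smul_apply, evm_apply, smul_eq_mul, div_mul_cancel₀ _ (h0 k)]
  · intro i _ hik
    rw [map_smul, Pi.smul_apply, evm_apply, h1 i k hik, smul_zero]
  · simp

theorem isHom_sub (p q : S) (hp : p.IsHomogeneous 1) (hq : q.IsHomogeneous 1) (s : ℝ) :
    (p - C s * q).IsHomogeneous 1 := hp.sub (hq.C_mul s)

theorem isHom_prod {ι : Type} (t : Finset ι) (p : ι → S) (hp : ∀ i, (p i).IsHomogeneous 1) :
    (∏ i ∈ t, p i).IsHomogeneous t.card := by
  have := IsHomogeneous.prod t p (fun _ => 1) (fun i _ => hp i)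
  simpa using this

/-- Unisolvence of triangular grids. -/
theorem unisolv (m : ℕ) (l : Fin 3 → S) (hl : ∀ i, (l i).IsHomogeneous 1)
    (P : Tri m → Fin 3 → ℝ) (hP : ∀ d i, eval (P d) (l i) = (d.1 i : ℝ))
    (hP2 : ∀ d, P d 2 = 1) (f : S) (hf : f.IsHomogeneous m) (h : ∀ d, eval (P d) f = 0) :
    f = 0 := by
  have hsurj : Function.Surjective (evm m P) := by
    apply evm_surj m P
      (fun d => ∏ i, ∏ s ∈ Finset.range (d.1 i), (l i - C (s : ℝ) * X 2))
    · intro d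
      have := IsHomogeneous.prod Finset.univ
        (fun i => ∏ s ∈ Finset.range (d.1 i), (l i - C (s : ℝ) * X 2)) (fun i => d.1 i)
        (fun i _ => by
          have := isHom_prod (Finset.range (d.1 i)) (fun s => l i - C (s : ℝ) * X 2)
            (fun s => isHom_sub _ _ (hl i) (isHomogeneous_X _ _) _)
          simpa using this)
      have h2 := (Finset.mem_finsuppAntidiag.1 d.2).1
      rwa [h2] at this
    · intro d
      simp only [map_prod, map_sub, map_mul, eval_C, eval_X, hP, hP2, mul_one]
      refine Finset.prod_ne_zero_iff.2 fun i _ => Finset.prod_ne_zero_iff.2 fun s hs => ?_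
      have := Finset.mem_range.1 hs
      rw [sub_ne_zero]
      exact_mod_cast this.ne'
    · intro d d' hdd
      simp only [map_prod, map_sub, map_mul, eval_C, eval_X, hP, hP2, mul_one]
      have h1 := (Finset.mem_finsuppAntidiag.1 d.2).1
      have h2 := (Finset.mem_finsuppAntidiag.1 d'.2).1
      have : ∃ i, d'.1 i < d.1 i := by
        by_contra hcon
        push Not at hcon
        apply hdd
        apply Subtype.ext
        ext i
        have := (Finset.sum_eq_sum_iff_of_le (s := Finset.univ) (fun i _ => hcon i)).1
          (h1.trans h2.symm)
        exact this i (Finset.mem_univ i)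
      obtain ⟨i, hi⟩ := this
      exact Finset.prod_eq_zero (Finset.mem_univ i)
        (Finset.prod_eq_zero (Finset.mem_range.2 hi) (sub_self _))
  have hinj : Function.Injective (evm m P) := by
    refine (LinearMap.injective_iff_surjective_of_finrank_eq_finrank ?_).2 hsurj
    rw [finrank_Hm, Module.finrank_fintype_fun_eq_card]
  have : (⟨f, hf⟩ : Hm m) = 0 := hinj (by
    funext d
    rw [evm_apply, h d, map_zero, Pi.zero_apply])
  exact congrArg Subtype.val this

/-! ### The three products -/

def Iv (j : ℕ) : Finset ℤ := Finset.Icc (-(j : ℤ)) (2 + j)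

def Fm (j : ℕ) : Fin 3 → S :=
  ![∏ s ∈ Iv j, (X 0 - C (s : ℝ) * X 2), ∏ s ∈ Iv j, (X 1 - C (s : ℝ) * X 2),
    ∏ s ∈ Iv j, (X 0 + X 1 - C (s : ℝ) * X 2)]

def lam : Fin 3 → S := ![X 0, X 1, X 0 + X 1]

theorem lam_hom (i : Fin 3) : (lam i).IsHomogeneous 1 :=
  fin3_all (P := fun i => (lam i).IsHomogeneous 1) (isHomogeneous_X _ _) (isHomogeneous_X _ _)
    ((isHomogeneous_X _ _).add (isHomogeneous_X _ _)) i

theorem Fm_eq (j : ℕ) (i : Fin 3) : Fm j i = ∏ s ∈ Iv j, (lam i - C (s : ℝ) * X 2) :=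
  fin3_all (P := fun i => Fm j i = ∏ s ∈ Iv j, (lam i - C (s : ℝ) * X 2)) rfl rfl rfl i

theorem card_Iv (j : ℕ) : (Iv j).card = 2 * (j + 1) + 1 := by
  simp [Iv]; omega

theorem Fm_hom (j : ℕ) (i : Fin 3) : (Fm j i).IsHomogeneous (2 * (j + 1) + 1) := by
  rw [Fm_eq, ← card_Iv]
  exact isHom_prod _ _ fun s => isHom_sub _ _ (lam_hom i) (isHomogeneous_X _ _) _

theorem eval_Fm (j : ℕ) (i : Fin 3) (v : Fin 3 → ℝ) (hv : v 2 = 1) :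
    eval v (Fm j i) = ∏ s ∈ Iv j, (eval v (lam i) - s) := by
  simp [Fm_eq, map_prod, hv]

theorem eval_Fm_zero (j : ℕ) (i : Fin 3) (v : Fin 3 → ℝ) (hv : v 2 = 1) (s : ℤ)
    (hs : -(j : ℤ) ≤ s ∧ s ≤ 2 + j) (h : eval v (lam i) = s) : eval v (Fm j i) = 0 := by
  rw [eval_Fm _ _ _ hv]
  exact Finset.prod_eq_zero (Finset.mem_Icc.2 hs) (by rw [h, sub_self])

theorem eval_Fm_ne (j : ℕ) (i : Fin 3) (v : Fin 3 → ℝ) (hv : v 2 = 1) (s : ℤ)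
    (hs : ¬ (-(j : ℤ) ≤ s ∧ s ≤ 2 + j)) (h : eval v (lam i) = s) : eval v (Fm j i) ≠ 0 := by
  rw [eval_Fm _ _ _ hv, Finset.prod_ne_zero_iff]
  intro t ht h'
  have ht' := Finset.mem_Icc.1 ht
  rw [h, sub_eq_zero] at h'
  have : s = t := by exact_mod_cast h'
  subst this
  exact hs ht'

theorem Fm_ne (j : ℕ) (i : Fin 3) : Fm j i ≠ 0 := by
  intro h
  have := eval_Fm_ne j i ![j + 3, j + 3, 1] rfl
  revert this
  rw [h]
  refine fin3_all (P := fun i => (∀ s : ℤ, ¬ (-(j : ℤ) ≤ s ∧ s ≤ 2 + j) →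
    eval ![(j + 3 : ℝ), j + 3, 1] (lam i) = s → eval ![(j + 3 : ℝ), j + 3, 1] (0 : S) ≠ 0) → False)
    ?_ ?_ ?_ i
  · intro h
    exact h (j + 3) (by omega) (by simp [lam]) (map_zero _)
  · intro h
    exact h (j + 3) (by omega) (by simp [lam]) (map_zero _)
  · intro h
    exact h (j + 3 + (j + 3)) (by omega) (by simp [lam]) (map_zero _)

theorem tri_sum (m : ℕ) (d : Tri m) : d.1 0 + d.1 1 + d.1 2 = m := by
  have := (Finset.mem_finsuppAntidiag.1 d.2).1
  rwa [Fin.sum_univ_three] at this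

/-- There are no syzygies of small degree. -/
theorem Fm_low (j : ℕ) (v : Fin 3 → S) (hv : IsSyz (Fm j) v) (m : ℕ) (hm : m ≤ j + 1)
    (hd : ∀ i, (v i).IsHomogeneous m) : v = 0 := by
  have hev : ∀ P : Fin 3 → ℝ, eval P (Fm j 0) * eval P (v 0) + eval P (Fm j 1) * eval P (v 1) +
      eval P (Fm j 2) * eval P (v 2) = 0 := by
    intro P
    have := congrArg (eval P) hv
    simpa using this
  have hX0 := isHomogeneous_X ℝ (0 : Fin 3)
  have hX1 := isHomogeneous_X ℝ (1 : Fin 3)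
  have hX2 := isHomogeneous_X ℝ (2 : Fin 3)
  have hd2 : ∀ d : Tri m, (d.1 2 : ℝ) = m - d.1 0 - d.1 1 := by
    intro d
    have := tri_sum m d
    have h' : (d.1 0 + d.1 1 + d.1 2 : ℝ) = m := by exact_mod_cast this
    linarith
  have hsum := tri_sum m
  refine funext (fin3_all ?_ ?_ ?_)
  · refine unisolv m ![X 0 + X 1 + C (j : ℝ) * X 2, C (j + 2 : ℝ) * X 2 - X 1,
      C (m : ℝ) * X 2 - (X 0 + X 1 + C (j : ℝ) * X 2) - (C (j + 2 : ℝ) * X 2 - X 1)] ?_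
      (fun d => ![-2 * j - 2 + d.1 0 + d.1 1, j + 2 - d.1 1, 1]) ?_ (fun d => rfl) (v 0) (hd 0) ?_
    · exact fin3_all ((hX0.add hX1).add (hX2.C_mul _)) ((hX2.C_mul _).sub hX1)
        (((hX2.C_mul _).sub ((hX0.add hX1).add (hX2.C_mul _))).sub ((hX2.C_mul _).sub hX1))
    · intro d
      refine fin3_all ?_ ?_ ?_
      · simp; ring
      · simp
      · simp [hd2]; ring
    · intro d
      have hs := hsum d
      have h := hev ![-2 * j - 2 + d.1 0 + d.1 1, j + 2 - d.1 1, 1]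
      rw [eval_Fm_zero j 1 _ rfl (j + 2 - d.1 1) (by omega) (by simp [lam]),
        eval_Fm_zero j 2 _ rfl (-j + d.1 0) (by omega) (by simp [lam]; ring)] at h
      have h0 := eval_Fm_ne j 0 ![-2 * j - 2 + d.1 0 + d.1 1, j + 2 - d.1 1, 1] rfl
        (-2 * j - 2 + d.1 0 + d.1 1) (by omega) (by simp [lam])
      rw [zero_mul, zero_mul] at h
      exact (mul_eq_zero.1 (by simpa only [add_zero, zero_add] using h)).resolve_left h0
  · refine unisolv m ![X 0 + X 1 + C (j : ℝ) * X 2, C (j + 2 : ℝ) * X 2 - X 0,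
      C (m : ℝ) * X 2 - (X 0 + X 1 + C (j : ℝ) * X 2) - (C (j + 2 : ℝ) * X 2 - X 0)] ?_
      (fun d => ![j + 2 - d.1 1, -2 * j - 2 + d.1 0 + d.1 1, 1]) ?_ (fun d => rfl) (v 1) (hd 1) ?_
    · exact fin3_all ((hX0.add hX1).add (hX2.C_mul _)) ((hX2.C_mul _).sub hX0)
        (((hX2.C_mul _).sub ((hX0.add hX1).add (hX2.C_mul _))).sub ((hX2.C_mul _).sub hX0))
    · intro d
      refine fin3_all ?_ ?_ ?_
      · simp; ring
      · simp
      · simp [hd2]; ring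
    · intro d
      have hs := hsum d
      have h := hev ![j + 2 - d.1 1, -2 * j - 2 + d.1 0 + d.1 1, 1]
      rw [eval_Fm_zero j 0 _ rfl (j + 2 - d.1 1) (by omega) (by simp [lam]),
        eval_Fm_zero j 2 _ rfl (-j + d.1 0) (by omega) (by simp [lam]; ring)] at h
      have h0 := eval_Fm_ne j 1 ![j + 2 - d.1 1, -2 * j - 2 + d.1 0 + d.1 1, 1] rfl
        (-2 * j - 2 + d.1 0 + d.1 1) (by omega) (by simp [lam])
      rw [zero_mul, zero_mul] at h
      exact (mul_eq_zero.1 (by simpa only [add_zero, zero_add] using h)).resolve_left h0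
  · refine unisolv m ![C (j + 2 : ℝ) * X 2 - X 0, C (j + 2 : ℝ) * X 2 - X 1,
      C (m : ℝ) * X 2 - (C (j + 2 : ℝ) * X 2 - X 0) - (C (j + 2 : ℝ) * X 2 - X 1)] ?_
      (fun d => ![j + 2 - d.1 0, j + 2 - d.1 1, 1]) ?_ (fun d => rfl) (v 2) (hd 2) ?_
    · exact fin3_all ((hX2.C_mul _).sub hX0) ((hX2.C_mul _).sub hX1)
        (((hX2.C_mul _).sub ((hX2.C_mul _).sub hX0)).sub ((hX2.C_mul _).sub hX1))
    · intro d
      refine fin3_all ?_ ?_ ?_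
      · simp
      · simp
      · simp [hd2]
    · intro d
      have hs := hsum d
      have h := hev ![j + 2 - d.1 0, j + 2 - d.1 1, 1]
      rw [eval_Fm_zero j 0 _ rfl (j + 2 - d.1 0) (by omega) (by simp [lam]),
        eval_Fm_zero j 1 _ rfl (j + 2 - d.1 1) (by omega) (by simp [lam])] at h
      have h0 := eval_Fm_ne j 2 ![j + 2 - d.1 0, j + 2 - d.1 1, 1] rfl
        (j + 2 - d.1 0 + (j + 2 - d.1 1)) (by omega) (by simp [lam])
      simpa [h0] using h

/-! ### The hexagon of common zeros -/

def Hex (j : ℕ) : Finset (ℤ × ℤ) := (Iv j ×ˢ Iv j).filter fun p => p.1 + p.2 ∈ Iv j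

theorem mem_Hex (j : ℕ) (p : ℤ × ℤ) : p ∈ Hex j ↔ (-(j : ℤ) ≤ p.1 ∧ p.1 ≤ 2 + j) ∧
    (-(j : ℤ) ≤ p.2 ∧ p.2 ≤ 2 + j) ∧ (-(j : ℤ) ≤ p.1 + p.2 ∧ p.1 + p.2 ≤ 2 + j) := by
  simp [Hex, Iv, and_assoc]

/-- A parametrisation of the hexagon by columns. -/
def hexPar (j : ℕ) : (Σ i : Fin (j + 3), Fin (2 * j + 3 - i)) ⊕
    (Σ i : Fin j, Fin (2 * j + 2 - i)) → Hex j
  | Sum.inl ⟨i, k⟩ => ⟨((i : ℕ), -(j : ℤ) + (k : ℕ)), by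
      rw [mem_Hex]; have := i.2; have := k.2; dsimp only; omega⟩
  | Sum.inr ⟨i, k⟩ => ⟨(-((i : ℕ) : ℤ) - 1, (j : ℤ) + 2 - (k : ℕ)), by
      rw [mem_Hex]; have := i.2; have := k.2; dsimp only; omega⟩

theorem hexPar_inj (j : ℕ) : Function.Injective (hexPar j) := by
  rintro (⟨i, k⟩ | ⟨i, k⟩) (⟨i', k'⟩ | ⟨i', k'⟩) h <;>
    simp only [hexPar, Subtype.mk.injEq, Prod.mk.injEq] at h
  · have h1 : i = i' := Fin.ext (by omega)
    subst h1
    have h2 : k = k' := Fin.ext (by omega)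
    rw [h2]
  · omega
  · omega
  · have h1 : i = i' := Fin.ext (by omega)
    subst h1
    have h2 : k = k' := Fin.ext (by omega)
    rw [h2]

theorem sum_aux (a n : ℕ) (h : n ≤ a + 1) :
    2 * ∑ i ∈ Finset.range n, (a - i) + n * n = 2 * a * n + n := by
  induction n with
  | zero => simp
  | succ n ih =>
    rw [Finset.sum_range_succ]
    have := ih (by omega)
    obtain ⟨b, rfl⟩ : ∃ b, a = b + n := ⟨a - n, by omega⟩
    rw [Nat.add_sub_cancel]
    nlinarith

theorem card_Hex (j : ℕ) : 3 * (j + 1) * (j + 2) ≤ Fintype.card (Hex j) := by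
  have h := Fintype.card_le_of_injective _ (hexPar_inj j)
  rw [Fintype.card_sum, Fintype.card_sigma, Fintype.card_sigma] at h
  simp only [Fintype.card_fin] at h
  rw [Fin.sum_univ_eq_sum_range (fun i => 2 * j + 3 - i) (j + 3),
    Fin.sum_univ_eq_sum_range (fun i => 2 * j + 2 - i) j] at h
  have h1 := sum_aux (2 * j + 3) (j + 3) (by omega)
  have h2 := sum_aux (2 * j + 2) j (by omega)
  nlinarith

def hexP (j : ℕ) (p : Hex j) : Fin 3 → ℝ := ![(p.1.1 : ℝ), (p.1.2 : ℝ), 1]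

theorem hex_surj (j : ℕ) : Function.Surjective (evm (3 * j + 5) (hexP j)) := by
  apply evm_surj _ _ (fun p => X 2 * (∏ s ∈ Finset.Ioc p.1.1 (2 + (j : ℤ)), (X 0 - C (s : ℝ) * X 2)) *
    (∏ s ∈ Finset.Ioc p.1.2 (2 + (j : ℤ)), (X 1 - C (s : ℝ) * X 2)) *
    (∏ s ∈ Finset.Ico (-(j : ℤ)) (p.1.1 + p.1.2), (X 0 + X 1 - C (s : ℝ) * X 2)))
  · intro p
    obtain ⟨h1, h2, h3⟩ := (mem_Hex j p.1).1 p.2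
    have hX0 := isHomogeneous_X ℝ (0 : Fin 3)
    have hX1 := isHomogeneous_X ℝ (1 : Fin 3)
    have hX2 := isHomogeneous_X ℝ (2 : Fin 3)
    have := ((hX2.mul (isHom_prod (Finset.Ioc p.1.1 (2 + (j : ℤ))) _
      (fun s : ℤ => isHom_sub _ _ hX0 hX2 (s : ℝ)))).mul
      (isHom_prod (Finset.Ioc p.1.2 (2 + (j : ℤ))) _
      (fun s : ℤ => isHom_sub _ _ hX1 hX2 (s : ℝ)))).mul
      (isHom_prod (Finset.Ico (-(j : ℤ)) (p.1.1 + p.1.2)) _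
      (fun s : ℤ => isHom_sub _ _ (hX0.add hX1) hX2 (s : ℝ)))
    convert this using 1
    simp only [Int.card_Ioc, Int.card_Ico]
    omega
  · intro p
    simp only [map_prod, map_sub, map_mul, map_add, eval_C, eval_X, hexP, Matrix.cons_val, mul_one,
      one_mul]
    refine mul_ne_zero (mul_ne_zero ?_ ?_) ?_
    · refine Finset.prod_ne_zero_iff.2 fun s hs => ?_
      have := Finset.mem_Ioc.1 hs
      rw [sub_ne_zero]
      exact_mod_cast this.1.ne
    · refine Finset.prod_ne_zero_iff.2 fun s hs => ?_
      have := Finset.mem_Ioc.1 hs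
      rw [sub_ne_zero]
      exact_mod_cast this.1.ne
    · refine Finset.prod_ne_zero_iff.2 fun s hs => ?_
      have := Finset.mem_Ico.1 hs
      rw [sub_ne_zero]
      exact_mod_cast this.2.ne'
  · intro p q hpq
    obtain ⟨h1, h2, h3⟩ := (mem_Hex j q.1).1 q.2
    simp only [map_prod, map_sub, map_mul, map_add, eval_C, eval_X, hexP, Matrix.cons_val, mul_one,
      one_mul]
    by_cases ha : p.1.1 < q.1.1
    · have e : ∏ x ∈ Finset.Ioc p.1.1 (2 + (j : ℤ)), ((q.1.1 : ℝ) - (x : ℝ)) = 0 :=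
        Finset.prod_eq_zero (Finset.mem_Ioc.2 ⟨ha, h1.2⟩) (sub_self _)
      rw [e, zero_mul, zero_mul]
    by_cases hb : p.1.2 < q.1.2
    · have e : ∏ x ∈ Finset.Ioc p.1.2 (2 + (j : ℤ)), ((q.1.2 : ℝ) - (x : ℝ)) = 0 :=
        Finset.prod_eq_zero (Finset.mem_Ioc.2 ⟨hb, h2.2⟩) (sub_self _)
      rw [e, mul_zero, zero_mul]
    have hc : q.1.1 + q.1.2 < p.1.1 + p.1.2 := by
      by_contra hc
      apply hpq
      apply Subtype.ext
      apply Prod.ext <;> omega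
    rw [Finset.prod_eq_zero (Finset.mem_Ico.2 ⟨h3.1, hc⟩) (by push_cast; ring), mul_zero]

/-- The map whose kernel consists of the syzygies of degree `j + 2`. -/
def syzMap (j : ℕ) : (Fin 3 → Hm (j + 2)) →ₗ[ℝ] Hm (3 * j + 5) where
  toFun v := ⟨Fm j 0 * (v 0 : S) + Fm j 1 * (v 1 : S) + Fm j 2 * (v 2 : S), by
    have h : ∀ i, (Fm j i * (v i : S)).IsHomogeneous (3 * j + 5) := by
      intro i
      have := (Fm_hom j i).mul (v i).2
      convert this using 1
      ring
    exact ((h 0).add (h 1)).add (h 2)⟩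
  map_add' v w := by
    apply Subtype.ext
    simp
    ring
  map_smul' c v := by
    apply Subtype.ext
    simp [smul_eq_C_mul]
    ring

theorem li3 {V : Type*} [AddCommGroup V] [Module ℝ V] (f : Fin 3 → V)
    (hf : LinearIndependent ℝ f) (x y z : ℝ) (h : x • f 0 + y • f 1 + z • f 2 = 0) :
    x = 0 ∧ y = 0 ∧ z = 0 := by
  have := Fintype.linearIndependent_iff.1 hf ![x, y, z] (by
    rw [Fin.sum_univ_three]
    exact h)
  exact ⟨this 0, this 1, this 2⟩

theorem ker3 {V W : Type*} [AddCommGroup V] [Module ℝ V] [AddCommGroup W] [Module ℝ W]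
    (φ : V →ₗ[ℝ] W) (h : 3 ≤ Module.finrank ℝ (LinearMap.ker φ)) :
    ∃ f : Fin 3 → V, (∀ k, φ (f k) = 0) ∧
      ∀ x y z : ℝ, x • f 0 + y • f 1 + z • f 2 = 0 → x = 0 ∧ y = 0 ∧ z = 0 := by
  obtain ⟨f, hf⟩ := exists_linearIndependent_of_le_finrank h
  refine ⟨fun k => f k, fun k => (f k).2, fun x y z h => li3 f hf x y z (Subtype.ext h)⟩

theorem syz_exist (j : ℕ) : ∃ g : Fin 3 → Fin 3 → S, (∀ k, IsSyz (Fm j) (g k)) ∧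
    (∀ k i, (g k i).IsHomogeneous (j + 1 + 1)) ∧ Ind (g 0) (g 1) (g 2) := by
  have h1 := LinearMap.finrank_range_add_finrank_ker (syzMap j)
  have h2 := LinearMap.finrank_range_add_finrank_ker (evm (3 * j + 5) (hexP j))
  rw [LinearMap.range_eq_top.2 (hex_surj j), finrank_top, Module.finrank_fintype_fun_eq_card,
    finrank_Hm, card_tri] at h2
  rw [Module.finrank_pi_fintype, Finset.sum_const, finrank_Hm, card_tri] at h1
  have h3 : LinearMap.range (syzMap j) ≤ LinearMap.ker (evm (3 * j + 5) (hexP j)) := by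
    rintro _ ⟨v, rfl⟩
    rw [LinearMap.mem_ker]
    funext p
    obtain ⟨k1, k2, k3⟩ := (mem_Hex j p.1).1 p.2
    rw [evm_apply]
    simp only [syzMap, LinearMap.coe_mk, AddHom.coe_mk, map_add, map_mul]
    rw [eval_Fm_zero j 0 (hexP j p) rfl p.1.1 k1 (by simp [lam, hexP]),
      eval_Fm_zero j 1 (hexP j p) rfl p.1.2 k2 (by simp [lam, hexP]),
      eval_Fm_zero j 2 (hexP j p) rfl (p.1.1 + p.1.2) k3 (by simp [lam, hexP])]
    simp
  have h4 := Submodule.finrank_mono h3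
  have h5 := card_Hex j
  have h6 : 3 ≤ Module.finrank ℝ (LinearMap.ker (syzMap j)) := by
    have e1 : 2 * (j + 2 + 2).choose 2 = (j + 4) * (j + 3) := by
      have := Nat.add_one_mul_choose_eq (j + 3) 1
      simp at this
      linarith
    have e2 : 2 * (3 * j + 5 + 2).choose 2 = (3 * j + 7) * (3 * j + 6) := by
      have := Nat.add_one_mul_choose_eq (3 * j + 6) 1
      simp at this
      linarith
    simp at h1
    nlinarith
  obtain ⟨f, hf0, hf⟩ := ker3 (syzMap j) h6
  refine ⟨fun k i => (f k i : S), ?_, ?_, ?_⟩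
  · intro k
    exact congrArg Subtype.val (hf0 k)
  · intro k i
    exact (f k i).2
  · intro x y z h
    apply hf x y z
    funext i
    apply Subtype.ext
    have h' := h i
    rw [← smul_eq_C_mul, ← smul_eq_C_mul, ← smul_eq_C_mul] at h'
    exact h'

/-! ### Coprimality of the linear factors -/

/-- The linear factor `lam i - s z`. -/
def al (i : Fin 3) (s : ℤ) : S := lam i - C (s : ℝ) * X 2

theorem al_hom (i : Fin 3) (s : ℤ) : (al i s).IsHomogeneous 1 :=
  isHom_sub _ _ (lam_hom i) (isHomogeneous_X _ _) _

theorem exists_pt (i : Fin 3) (a : ℝ) : ∃ v : Fin 3 → ℝ, v 2 = 1 ∧ eval v (lam i) = a := by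
  refine fin3_all (P := fun i => ∃ v : Fin 3 → ℝ, v 2 = 1 ∧ eval v (lam i) = a) ?_ ?_ ?_ i
  · exact ⟨![a, 0, 1], rfl, by simp [lam]⟩
  · exact ⟨![0, a, 1], rfl, by simp [lam]⟩
  · exact ⟨![a, 0, 1], rfl, by simp [lam]⟩

theorem exists_pt2 (i k : Fin 3) (h : i ≠ k) (a b : ℝ) :
    ∃ v : Fin 3 → ℝ, v 2 = 1 ∧ eval v (lam i) = a ∧ eval v (lam k) = b := by
  revert h
  refine fin3_all (P := fun i => i ≠ k → ∃ v : Fin 3 → ℝ, v 2 = 1 ∧ eval v (lam i) = a ∧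
    eval v (lam k) = b) ?_ ?_ ?_ i <;>
  refine fin3_all (P := fun k => _ ≠ k → ∃ v : Fin 3 → ℝ, v 2 = 1 ∧ eval v (lam _) = a ∧
    eval v (lam k) = b) ?_ ?_ ?_ k
  · intro h; exact absurd rfl h
  · intro _; exact ⟨![a, b, 1], rfl, by simp [lam], by simp [lam]⟩
  · intro _; exact ⟨![a, b - a, 1], rfl, by simp [lam], by simp [lam]⟩
  · intro _; exact ⟨![b, a, 1], rfl, by simp [lam], by simp [lam]⟩
  · intro h; exact absurd rfl h
  · intro _; exact ⟨![b - a, a, 1], rfl, by simp [lam], by simp [lam]⟩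
  · intro _; exact ⟨![b, a - b, 1], rfl, by simp [lam], by simp [lam]⟩
  · intro _; exact ⟨![a - b, b, 1], rfl, by simp [lam], by simp [lam]⟩
  · intro h; exact absurd rfl h

theorem al_ne (i : Fin 3) (s : ℤ) : al i s ≠ 0 := by
  intro h
  obtain ⟨v, h2, hv⟩ := exists_pt i (s + 1)
  have := congrArg (eval v) h
  simp [al, h2, hv] at this

theorem al_rel (i : Fin 3) (s : ℤ) (q : S) (v : Fin 3 → ℝ) (h2 : v 2 = 1)
    (hv : eval v (lam i) = s) (hq : eval v q ≠ 0) : IsRelPrime (al i s) q :=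
  relprime_lin _ _ (al_hom i s) v (by simp [al, h2, hv]) hq (al_ne i s)

theorem al_rel_X (i : Fin 3) (s : ℤ) : IsRelPrime (al i s) (X 2) := by
  obtain ⟨v, h2, hv⟩ := exists_pt i s
  exact al_rel i s _ v h2 hv (by simp [h2])

theorem al_rel_same (i : Fin 3) (s t : ℤ) (h : s ≠ t) : IsRelPrime (al i s) (al i t) := by
  obtain ⟨v, h2, hv⟩ := exists_pt i s
  refine al_rel i s _ v h2 hv ?_
  simp only [al, map_sub, map_mul, eval_C, eval_X, h2, hv, mul_one, sub_ne_zero]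
  exact_mod_cast h

theorem al_rel_diff (i k : Fin 3) (h : i ≠ k) (s t : ℤ) : IsRelPrime (al i s) (al k t) := by
  obtain ⟨v, h2, hv, hw⟩ := exists_pt2 i k h s (t + 1)
  exact al_rel i s _ v h2 hv (by simp [al, h2, hw])

theorem Fm_al (j : ℕ) (i : Fin 3) : Fm j i = ∏ s ∈ Iv j, al i s := Fm_eq j i

theorem Fm_rel (j : ℕ) : IsRelPrime (Fm j 0) (Fm j 1) := by
  rw [Fm_al, Fm_al]
  exact IsRelPrime.prod_left fun s _ => IsRelPrime.prod_right fun t _ =>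
    al_rel_diff _ _ (by decide) _ _

theorem fjk_eq (j : ℕ) : fjk j 2 = X 2 * ∏ i, Fm j i := by
  rw [Fin.prod_univ_three, fjk, Finset.prod_mul_distrib, Finset.prod_mul_distrib]
  rfl

theorem fjk_ne (j : ℕ) : fjk j 2 ≠ 0 := by
  rw [fjk_eq]
  exact mul_ne_zero (X_ne_zero _) (Finset.prod_ne_zero_iff.2 fun i _ => Fm_ne j i)

theorem fjk_hom (j : ℕ) : (fjk j 2).IsHomogeneous (6 * j + 10) := by
  rw [fjk_eq, Fin.prod_univ_three]
  have := (isHomogeneous_X ℝ (2 : Fin 3)).mul (((Fm_hom j 0).mul (Fm_hom j 1)).mul (Fm_hom j 2))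
  convert this using 1
  ring

/-- Factor out one linear form. -/
theorem fjk_factor (j : ℕ) (i : Fin 3) (s : ℤ) (hs : s ∈ Iv j) :
    ∃ h, fjk j 2 = al i s * h ∧ IsRelPrime (al i s) h := by
  refine ⟨X 2 * ((∏ t ∈ (Iv j).erase s, al i t) * ∏ k ∈ Finset.univ.erase i, Fm j k), ?_, ?_⟩
  · rw [fjk_eq, ← Finset.mul_prod_erase Finset.univ (Fm j) (Finset.mem_univ i),
      Fm_al j i, ← Finset.mul_prod_erase (Iv j) (al i) hs]
    ring
  · refine (al_rel_X i s).mul_right (IsRelPrime.mul_right ?_ ?_)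
    · exact IsRelPrime.prod_right fun t ht => al_rel_same i s t (Finset.ne_of_mem_erase ht).symm
    · refine IsRelPrime.prod_right fun k hk => ?_
      rw [Fm_al]
      exact IsRelPrime.prod_right fun t _ =>
        al_rel_diff i k (Finset.ne_of_mem_erase hk).symm s t

theorem log_dvd (D : Derivation ℝ S S) (f a h : S) (hf : f = a * h) (hr : IsRelPrime a h)
    (hD : D f = 0) : a ∣ D a := by
  rw [hf, D.leibniz, smul_eq_mul, smul_eq_mul] at hD
  refine hr.dvd_of_dvd_mul_left (Dvd.intro (-(D h)) ?_)
  linear_combination -hD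

theorem X2_dvd (j : ℕ) (D : Derivation ℝ S S) (hD : D (fjk j 2) = 0) : X 2 ∣ D (X 2) := by
  refine log_dvd D _ _ _ (fjk_eq j) (IsRelPrime.prod_right fun i _ => ?_) hD
  rw [Fm_al]
  exact IsRelPrime.prod_right fun t _ => (al_rel_X i t).symm

/-! ### The Euler derivation -/

def Eu : Derivation ℝ S S := (X 0 : S) • pderiv 0 + (X 1 : S) • pderiv 1 + (X 2 : S) • pderiv 2

theorem Eu_apply (n : ℕ) (f : S) (hf : f.IsHomogeneous n) : Eu f = C (n : ℝ) * f := by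
  have := hf.sum_X_mul_pderiv
  rw [Fin.sum_univ_three, nsmul_eq_mul] at this
  simp only [Eu, Derivation.add_apply, Derivation.smul_apply, smul_eq_mul]
  rw [this]
  simp

theorem Eu_lin (f : S) (hf : f.IsHomogeneous 1) : Eu f = f := by
  rw [Eu_apply 1 f hf]
  simp

/-! ### From derivations to syzygies -/

theorem der_struct (j : ℕ) (D : Derivation ℝ S S) (hD : D (fjk j 2) = 0) :
    ∃ t : S, ∃ v : Fin 3 → S, IsSyz (Fm j) v ∧ D (X 0) = Fm j 0 * v 0 + t * X 0 ∧
      D (X 1) = Fm j 1 * v 1 + t * X 1 ∧ D (X 2) = t * X 2 := by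
  obtain ⟨t, ht⟩ := X2_dvd j D hD
  have h1 : ∀ i, ∃ w, D (lam i) - t * lam i = Fm j i * w := by
    intro i
    rw [Fm_al]
    refine Finset.prod_dvd_of_isRelPrime (fun s _ s' _ h => al_rel_same i s s' h) fun s hs => ?_
    obtain ⟨h, hf, hr⟩ := fjk_factor j i s hs
    obtain ⟨u, hu⟩ := log_dvd D _ _ _ hf hr hD
    refine ⟨u - t, ?_⟩
    have : D (al i s) = D (lam i) - C (s : ℝ) * D (X 2) := by
      rw [al, map_sub, D.leibniz, ← algebraMap_eq, D.map_algebraMap]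
      simp
    rw [mul_sub, ← hu, this, ht, al]
    ring
  choose w hw using h1
  have e0 := hw 0
  have e1 := hw 1
  have e2 := hw 2
  simp only [lam, Matrix.cons_val, map_add] at e0 e1 e2
  refine ⟨t, ![w 0, w 1, -w 2], ?_, ?_, ?_, ?_⟩
  · simp only [IsSyz, Matrix.cons_val]
    linear_combination e2 - e0 - e1
  · simp only [Matrix.cons_val]
    linear_combination e0
  · simp only [Matrix.cons_val]
    linear_combination e1
  · rw [ht, mul_comm]

/-! ### From syzygies to derivations -/

def Gm (j : ℕ) (i : Fin 3) : S := ∑ s ∈ Iv j, ∏ t ∈ (Iv j).erase s, al i t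

theorem Gm_hom (j : ℕ) (i : Fin 3) : (Gm j i).IsHomogeneous (2 * (j + 1)) := by
  refine IsHomogeneous.sum _ _ _ fun s hs => ?_
  have := isHom_prod ((Iv j).erase s) (al i) (al_hom i)
  rwa [Finset.card_erase_of_mem hs, card_Iv, Nat.add_sub_cancel] at this

theorem prod_der (D : Derivation ℝ S S) (hD : D (X 2) = 0) (i : Fin 3) (T : Finset ℤ) :
    D (∏ s ∈ T, al i s) = (∑ s ∈ T, ∏ t ∈ T.erase s, al i t) * D (lam i) := by
  have h1 : ∀ s, D (al i s) = D (lam i) := by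
    intro s
    rw [al, map_sub, D.leibniz, ← algebraMap_eq, D.map_algebraMap, hD]
    simp
  induction T using Finset.induction_on with
  | empty => simp
  | insert a T ha ih =>
    rw [Finset.prod_insert ha, D.leibniz, ih, h1, Finset.sum_insert ha, Finset.erase_insert ha]
    have : ∑ s ∈ T, ∏ t ∈ (insert a T).erase s, al i t =
        al i a * ∑ s ∈ T, ∏ t ∈ T.erase s, al i t := by
      rw [Finset.mul_sum]
      refine Finset.sum_congr rfl fun s hs => ?_
      have hne : a ≠ s := fun h => ha (h ▸ hs)
      rw [Finset.erase_insert_of_ne hne, Finset.prod_insert (fun h => ha (Finset.mem_of_mem_erase h))]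
    rw [this, smul_eq_mul, smul_eq_mul]
    ring

theorem Fm_der (j : ℕ) (D : Derivation ℝ S S) (hD : D (X 2) = 0) (i : Fin 3) :
    D (Fm j i) = Gm j i * D (lam i) := by
  rw [Fm_al, prod_der D hD i, Gm]

def dv (j : ℕ) (v : Fin 3 → S) : S := Gm j 0 * v 0 + Gm j 1 * v 1 - Gm j 2 * v 2

def Et (j : ℕ) (v : Fin 3 → S) : Derivation ℝ S S :=
  (Fm j 0 * v 0) • pderiv 0 + (Fm j 1 * v 1) • pderiv 1

theorem Et_X (j : ℕ) (v : Fin 3 → S) : Et j v (X 0) = Fm j 0 * v 0 ∧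
    Et j v (X 1) = Fm j 1 * v 1 ∧ Et j v (X 2) = 0 := by
  simp [Et, pderiv_X]

theorem Et_f (j : ℕ) (v : Fin 3 → S) (hv : IsSyz (Fm j) v) :
    Et j v (fjk j 2) = dv j v * fjk j 2 := by
  obtain ⟨h0, h1, h2⟩ := Et_X j v
  have e0 := Fm_der j (Et j v) h2 0
  have e1 := Fm_der j (Et j v) h2 1
  have e2 := Fm_der j (Et j v) h2 2
  have a0 : Et j v (lam 0) = Fm j 0 * v 0 := h0
  have a1 : Et j v (lam 1) = Fm j 1 * v 1 := h1
  have a2 : Et j v (lam 2) = - (Fm j 2 * v 2) := by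
    have : Et j v (lam 2) = Et j v (X 0) + Et j v (X 1) := map_add _ _ _
    rw [this, h0, h1]
    have hv' : Fm j 0 * v 0 + Fm j 1 * v 1 + Fm j 2 * v 2 = 0 := hv
    linear_combination hv'
  rw [fjk_eq, Fin.prod_univ_three]
  simp only [Derivation.leibniz, smul_eq_mul, h2, e0, e1, e2, a0, a1, a2, dv]
  ring

def Th (j : ℕ) (v : Fin 3 → S) : Derivation ℝ S S :=
  Et j v - (C ((6 * j + 10 : ℕ) : ℝ)⁻¹ * dv j v) • Eu

theorem N_ne (j : ℕ) : (((6 * j + 10 : ℕ) : ℝ)) ≠ 0 := by positivity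

theorem Th_mem (j : ℕ) (v : Fin 3 → S) (hv : IsSyz (Fm j) v) : Th j v ∈ D0 (fjk j 2) := by
  change Th j v (fjk j 2) = 0
  rw [Th, Derivation.sub_apply, Derivation.smul_apply, Et_f j v hv, Eu_apply _ _ (fjk_hom j),
    smul_eq_mul]
  have : (C (((6 * j + 10 : ℕ) : ℝ)⁻¹) : S) * C (((6 * j + 10 : ℕ) : ℝ)) = 1 := by
    rw [← C_mul, inv_mul_cancel₀ (N_ne j), C_1]
  linear_combination (-(dv j v * fjk j 2)) * this

theorem Th_comb (j : ℕ) (p : Fin 3 → S) (g : Fin 3 → Fin 3 → S) (v : Fin 3 → S)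
    (hv : ∀ i, v i = p 0 * g 0 i + p 1 * g 1 i + p 2 * g 2 i) :
    Th j v = p 0 • Th j (g 0) + p 1 • Th j (g 1) + p 2 • Th j (g 2) := by
  apply derivation_ext
  intro i
  simp only [Th, Et, dv, hv, Derivation.sub_apply, Derivation.add_apply, Derivation.smul_apply,
    smul_eq_mul]
  ring

theorem Th_X (j : ℕ) (v : Fin 3 → S) (i : Fin 3) :
    Th j v (X i) = Et j v (X i) - C ((6 * j + 10 : ℕ) : ℝ)⁻¹ * dv j v * X i := by
  rw [Th, Derivation.sub_apply, Derivation.smul_apply, Eu_lin _ (isHomogeneous_X _ _), smul_eq_mul]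

theorem Th_inj (j : ℕ) (v : Fin 3 → S) (hv : IsSyz (Fm j) v) (h : Th j v = 0) : v = 0 := by
  obtain ⟨h0, h1, h2⟩ := Et_X j v
  have hX : ∀ i, Th j v (X i) = 0 := fun i => by rw [h]; rfl
  have k2 := hX 2
  rw [Th_X, h2, zero_sub, neg_eq_zero] at k2
  have k := (mul_eq_zero.1 k2).resolve_right (X_ne_zero _)
  have k0 := hX 0
  rw [Th_X, h0, k, zero_mul, sub_zero] at k0
  have k1 := hX 1
  rw [Th_X, h1, k, zero_mul, sub_zero] at k1
  have hv' : Fm j 0 * v 0 + Fm j 1 * v 1 + Fm j 2 * v 2 = 0 := hv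
  rw [k0, k1, zero_add, zero_add] at hv'
  exact funext (fin3_all ((mul_eq_zero.1 k0).resolve_left (Fm_ne j 0))
    ((mul_eq_zero.1 k1).resolve_left (Fm_ne j 1))
    ((mul_eq_zero.1 hv').resolve_left (Fm_ne j 2)))

theorem Th_surj (j : ℕ) (D : Derivation ℝ S S) (hD : D (fjk j 2) = 0) :
    ∃ v, IsSyz (Fm j) v ∧ D = Th j v := by
  obtain ⟨t, v, hv, d0, d1, d2⟩ := der_struct j D hD
  obtain ⟨h0, h1, h2⟩ := Et_X j v
  refine ⟨v, hv, ?_⟩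
  have e : D = Et j v + t • Eu := by
    apply derivation_ext
    intro i
    rw [Derivation.add_apply, Derivation.smul_apply, Eu_lin _ (isHomogeneous_X _ _), smul_eq_mul]
    refine fin3_all (P := fun i => D (X i) = Et j v (X i) + t * X i) ?_ ?_ ?_ i
    · rw [h0, d0]
    · rw [h1, d1]
    · rw [h2, d2, zero_add]
  have ht : t = - (C ((6 * j + 10 : ℕ) : ℝ)⁻¹ * dv j v) := by
    rw [e, Derivation.add_apply, Derivation.smul_apply, Et_f j v hv, Eu_apply _ _ (fjk_hom j),
      smul_eq_mul] at hD
    have h3 : (dv j v + t * C (((6 * j + 10 : ℕ) : ℝ))) * fjk j 2 = 0 := by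
      linear_combination hD
    have h4 := (mul_eq_zero.1 h3).resolve_right (fjk_ne j)
    have : (C (((6 * j + 10 : ℕ) : ℝ)⁻¹) : S) * C (((6 * j + 10 : ℕ) : ℝ)) = 1 := by
      rw [← C_mul, inv_mul_cancel₀ (N_ne j), C_1]
    linear_combination C (((6 * j + 10 : ℕ) : ℝ)⁻¹) * h4 - t * this
  rw [e, Th, ht]
  apply derivation_ext
  intro i
  simp only [Derivation.sub_apply, Derivation.add_apply, Derivation.smul_apply, smul_eq_mul]
  ring

theorem Th_hom (j : ℕ) (v : Fin 3 → S) (hv : ∀ i, (v i).IsHomogeneous (j + 1 + 1)) :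
    IsHomogDer (Th j v) (3 * j + 5) := by
  obtain ⟨h0, h1, h2⟩ := Et_X j v
  have hF : ∀ i, (Fm j i * v i).IsHomogeneous (3 * j + 5) := fun i => by
    convert (Fm_hom j i).mul (hv i) using 1
    ring
  have hG : ∀ i, (Gm j i * v i).IsHomogeneous (3 * j + 4) := fun i => by
    convert (Gm_hom j i).mul (hv i) using 1
    ring
  have hdv : (dv j v).IsHomogeneous (3 * j + 4) := ((hG 0).add (hG 1)).sub (hG 2)
  intro i
  rw [Th_X]
  refine IsHomogeneous.sub ?_ ?_
  · refine fin3_all (P := fun i => (Et j v (X i)).IsHomogeneous (3 * j + 5)) ?_ ?_ ?_ i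
    · rw [h0]; exact hF 0
    · rw [h1]; exact hF 1
    · rw [h2]; exact isHomogeneous_zero _ _ _
  · exact (hdv.C_mul _).mul (isHomogeneous_X _ _)

/-! ### Presentation of `D0` -/

theorem D0_pres (j : ℕ) : ∃ T : Fin 3 → Derivation ℝ S S, (∀ k, T k ∈ D0 (fjk j 2)) ∧
    (∀ k, IsHomogDer (T k) (3 * j + 5)) ∧
    (∀ D ∈ D0 (fjk j 2), ∃ p : Fin 3 → S, p 0 • T 0 + p 1 • T 1 + p 2 • T 2 = D) ∧
    (∀ p : Fin 3 → S, p 0 • T 0 + p 1 • T 1 + p 2 • T 2 = 0 ↔ ∃ q, ∀ k, p k = q * X k) := by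
  obtain ⟨g₀, hg₀, hgd₀, hind₀⟩ := syz_exist j
  obtain ⟨g, hg, hgd, hgen, hrel, hX⟩ := syz_structure (Fm j) (j + 1) (Fm_hom j) (Fm_rel j)
    (Fm_ne j) (Fm_low j) g₀ hg₀ hgd₀ hind₀
  refine ⟨fun k => Th j (g k), fun k => Th_mem j _ (hg k), fun k => Th_hom j _ (hgd k), ?_, ?_⟩
  · intro D hD
    obtain ⟨v, hv, rfl⟩ := Th_surj j D hD
    obtain ⟨p, hp⟩ := hgen v hv
    exact ⟨p, (Th_comb j p g v hp).symm⟩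
  · intro p
    dsimp only
    rw [← Th_comb j p g (fun i => p 0 * g 0 i + p 1 * g 1 i + p 2 * g 2 i) fun i => rfl]
    constructor
    · intro h
      apply hrel
      have hs : IsSyz (Fm j) (fun i => p 0 * g 0 i + p 1 * g 1 i + p 2 * g 2 i) := by
        have a0 : Fm j 0 * g 0 0 + Fm j 1 * g 0 1 + Fm j 2 * g 0 2 = 0 := hg 0
        have a1 : Fm j 0 * g 1 0 + Fm j 1 * g 1 1 + Fm j 2 * g 1 2 = 0 := hg 1
        have a2 : Fm j 0 * g 2 0 + Fm j 1 * g 2 1 + Fm j 2 * g 2 2 = 0 := hg 2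
        simp only [IsSyz]
        linear_combination p 0 * a0 + p 1 * a1 + p 2 * a2
      exact congrFun (Th_inj j _ hs h)
    · rintro ⟨q, hq⟩
      have : (fun i => p 0 * g 0 i + p 1 * g 1 i + p 2 * g 2 i) = 0 := by
        funext i
        simp only [hq, Pi.zero_apply]
        linear_combination q * hX i
      rw [this]
      apply derivation_ext
      intro i
      simp [Th, Et, dv]

/-! ### The final assembly -/

/-- The presentation map attached to three generators. -/
def Psi (N : Submodule S (Derivation ℝ S S)) (T : Fin 3 → Derivation ℝ S S)
    (hT : ∀ k, T k ∈ N) : (Fin 3 → S) →ₗ[S] N where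
  toFun p := ⟨p 0 • T 0 + p 1 • T 1 + p 2 • T 2,
    N.add_mem (N.add_mem (N.smul_mem _ (hT 0)) (N.smul_mem _ (hT 1))) (N.smul_mem _ (hT 2))⟩
  map_add' p q := by
    apply Subtype.ext
    apply derivation_ext
    intro i
    simp only [Pi.add_apply, Submodule.coe_add, Derivation.add_apply, Derivation.smul_apply,
      smul_eq_mul]
    ring
  map_smul' c p := by
    apply Subtype.ext
    apply derivation_ext
    intro i
    simp only [Pi.smul_apply, Submodule.coe_smul, Derivation.add_apply, Derivation.smul_apply,
      smul_eq_mul, RingHom.id_apply]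
    ring

theorem Psi_apply (N : Submodule S (Derivation ℝ S S)) (T : Fin 3 → Derivation ℝ S S)
    (hT : ∀ k, T k ∈ N) (p : Fin 3 → S) (i : Fin 3) :
    (Psi N T hT p : Derivation ℝ S S) (X i) =
      p 0 * T 0 (X i) + p 1 * T 1 (X i) + p 2 * T 2 (X i) := by
  simp only [Psi, LinearMap.coe_mk, AddHom.coe_mk, Derivation.add_apply, Derivation.smul_apply,
    smul_eq_mul]

theorem iso_of_ker {A B M : Type*} [AddCommMonoid A] [AddCommMonoid B] [AddCommMonoid M]
    [Module S A] [Module S B] [Module S M] (f : M →ₗ[S] A) (g : M →ₗ[S] B)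
    (hf : Function.Surjective f) (hg : Function.Surjective g)
    (h : ∀ p q, f p = f q ↔ g p = g q) : ∃ φ : A ≃ₗ[S] B, ∀ p, φ (f p) = g p := by
  choose s hs using hf
  have key : ∀ p, g (s (f p)) = g p := fun p => (h _ _).1 (hs _)
  let φ : A →ₗ[S] B :=
    { toFun := fun a => g (s a)
      map_add' := fun a b => by
        rw [← map_add, ← h, map_add, hs, hs, hs]
      map_smul' := fun c a => by
        rw [RingHom.id_apply, ← map_smul, ← h, map_smul, hs, hs] }
  have hφ : ∀ p, φ (f p) = g p := key
  refine ⟨LinearEquiv.ofBijective φ ⟨fun a b hab => ?_, fun b => ?_⟩, hφ⟩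
  · have : g (s a) = g (s b) := hab
    rwa [← h, hs, hs] at this
  · obtain ⟨p, rfl⟩ := hg b
    exact ⟨f p, hφ p⟩

theorem Psi_ker (N : Submodule S (Derivation ℝ S S)) (T : Fin 3 → Derivation ℝ S S)
    (hT : ∀ k, T k ∈ N)
    (hker : ∀ p : Fin 3 → S, p 0 • T 0 + p 1 • T 1 + p 2 • T 2 = 0 ↔ ∃ q, ∀ k, p k = q * X k)
    (p q : Fin 3 → S) : Psi N T hT p = Psi N T hT q ↔ ∃ r, ∀ k, (p - q) k = r * X k := by
  rw [← hker, Subtype.ext_iff]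
  constructor
  · intro h
    apply derivation_ext
    intro i
    have := congrArg (fun D : Derivation ℝ S S => D (X i)) h
    simp only [Psi_apply] at this
    simp only [Pi.sub_apply, Derivation.add_apply, Derivation.smul_apply, smul_eq_mul,
      Derivation.zero_apply]
    linear_combination this
  · intro h
    apply derivation_ext
    intro i
    have := congrArg (fun D : Derivation ℝ S S => D (X i)) h
    simp only [Pi.sub_apply, Derivation.add_apply, Derivation.smul_apply, smul_eq_mul,
      Derivation.zero_apply] at this
    rw [Psi_apply, Psi_apply]
    linear_combination this

theorem Psi_low (N : Submodule S (Derivation ℝ S S)) (T : Fin 3 → Derivation ℝ S S)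
    (hT : ∀ k, T k ∈ N) (m : ℕ) (hTd : ∀ k, IsHomogDer (T k) m) (d : ℕ) (hd : d < m)
    (p : Fin 3 → S) (hθ : IsHomogDer (Psi N T hT p : Derivation ℝ S S) d) : Psi N T hT p = 0 := by
  apply Subtype.ext
  apply derivation_ext
  intro i
  have hc := homogeneousComponent_of_mem (n := d) (m := d)
    ((mem_homogeneousSubmodule _ _).2 (hθ i))
  rw [if_pos rfl] at hc
  rw [← hc, Psi_apply, map_add, map_add, hc_mul_lt _ _ hd _ _ (hTd 0 i),
    hc_mul_lt _ _ hd _ _ (hTd 1 i), hc_mul_lt _ _ hd _ _ (hTd 2 i)]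
  simp

theorem Psi_comp (N : Submodule S (Derivation ℝ S S)) (T : Fin 3 → Derivation ℝ S S)
    (hT : ∀ k, T k ∈ N) (m : ℕ) (hTd : ∀ k, IsHomogDer (T k) m) (e : ℕ)
    (p : Fin 3 → S) (hθ : IsHomogDer (Psi N T hT p : Derivation ℝ S S) (e + m)) :
    Psi N T hT p = Psi N T hT (fun k => homogeneousComponent e (p k)) := by
  apply Subtype.ext
  apply derivation_ext
  intro i
  have hc := homogeneousComponent_of_mem (n := e + m) (m := e + m)
    ((mem_homogeneousSubmodule _ _).2 (hθ i))
  rw [if_pos rfl] at hc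
  rw [← hc, Psi_apply, Psi_apply, map_add, map_add, hc_mul_add _ _ _ _ (hTd 0 i),
    hc_mul_add _ _ _ _ (hTd 1 i), hc_mul_add _ _ _ _ (hTd 2 i)]

theorem Psi_hom (N : Submodule S (Derivation ℝ S S)) (T : Fin 3 → Derivation ℝ S S)
    (hT : ∀ k, T k ∈ N) (m : ℕ) (hTd : ∀ k, IsHomogDer (T k) m) (e : ℕ)
    (p : Fin 3 → S) (hp : ∀ k, (p k).IsHomogeneous e) :
    IsHomogDer (Psi N T hT p : Derivation ℝ S S) (e + m) := by
  intro i
  rw [Psi_apply]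
  have hh : ∀ k, (p k * T k (X i)).IsHomogeneous (e + m) := fun k => (hp k).mul (hTd k i)
  exact ((hh 0).add (hh 1)).add (hh 2)

theorem main_aux (j : ℕ) (N M : Submodule S (Derivation ℝ S S)) (T U : Fin 3 → Derivation ℝ S S)
    (hT : ∀ k, T k ∈ N) (hU : ∀ k, U k ∈ M)
    (hTd : ∀ k, IsHomogDer (T k) (3 * (j + 1) + 5)) (hUd : ∀ k, IsHomogDer (U k) (3 * j + 5))
    (hTgen : ∀ D ∈ N, ∃ p : Fin 3 → S, p 0 • T 0 + p 1 • T 1 + p 2 • T 2 = D)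
    (hUgen : ∀ D ∈ M, ∃ p : Fin 3 → S, p 0 • U 0 + p 1 • U 1 + p 2 • U 2 = D)
    (hTker : ∀ p : Fin 3 → S, p 0 • T 0 + p 1 • T 1 + p 2 • T 2 = 0 ↔ ∃ q, ∀ k, p k = q * X k)
    (hUker : ∀ p : Fin 3 → S, p 0 • U 0 + p 1 • U 1 + p 2 • U 2 = 0 ↔ ∃ q, ∀ k, p k = q * X k) :
    ∃ φ : N ≃ₗ[S] M, ∀ d : ℕ, ∀ θ : N,
      IsHomogDer (θ : Derivation ℝ S S) (d + 3) → IsHomogDer ((φ θ : Derivation ℝ S S)) d := by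
  have hTs : Function.Surjective (Psi _ T hT) := fun θ => by
    obtain ⟨p, hp⟩ := hTgen θ.1 θ.2
    exact ⟨p, Subtype.ext hp⟩
  have hUs : Function.Surjective (Psi _ U hU) := fun θ => by
    obtain ⟨p, hp⟩ := hUgen θ.1 θ.2
    exact ⟨p, Subtype.ext hp⟩
  have hker : ∀ p q, Psi N T hT p = Psi N T hT q ↔ Psi M U hU p = Psi M U hU q := by
    intro p q
    rw [Psi_ker N T hT hTker, Psi_ker M U hU hUker]
  obtain ⟨φ, hφ⟩ := iso_of_ker (Psi N T hT) (Psi M U hU) hTs hUs hker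
  refine ⟨φ, fun d θ hθ => ?_⟩
  obtain ⟨p, rfl⟩ := hTs θ
  by_cases hd : d < 3 * j + 5
  · rw [Psi_low _ T hT _ hTd _ (by omega) p hθ, map_zero]
    intro i
    exact isHomogeneous_zero _ _ _
  · obtain ⟨e, rfl⟩ : ∃ e, d = e + (3 * j + 5) := ⟨d - (3 * j + 5), by omega⟩
    rw [show e + (3 * j + 5) + 3 = e + (3 * (j + 1) + 5) by ring] at hθ
    rw [Psi_comp _ T hT _ hTd e p hθ, hφ]
    exact Psi_hom _ U hU _ hUd e _ fun k => homogeneousComponent_isHomogeneous e (p k)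

/-- The shift isomorphism holds for `k = 2`: there is a graded `S`-linear isomorphism
`D_0(f_{j+1,2}) ≅ D_0(f_{j,2})` shifting degrees by the Coxeter number 3, i.e.
`T_A ≅ T_B(3)` for `A = A_{A2}^{[-j,2+j]}`, `B = A_{A2}^{[-j-1,3+j]}`. -/
theorem shift_isomorphism_holds_k_two (j : ℕ) :
    ∃ φ : D0 (fjk (j + 1) 2) ≃ₗ[S] D0 (fjk j 2),
      ∀ d : ℕ, ∀ θ : D0 (fjk (j + 1) 2),
        IsHomogDer (θ : Derivation ℝ S S) (d + 3) →
          IsHomogDer ((φ θ : Derivation ℝ S S)) d := by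
  obtain ⟨T, hT, hTd, hTgen, hTker⟩ := D0_pres (j + 1)
  obtain ⟨U, hU, hUd, hUgen, hUker⟩ := D0_pres j
  exact main_aux j _ _ T U hT hU hTd hUd hTgen hUgen hTker hUker
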